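/- Let p be a prime and let G₁, G₂ be finite groups. Then the following are equivalent: (i) for every finite p-group Q, the F_p[Out(Q)]-modules F_p Inj(Q,G₁) and F_p Inj(Q,G₂) are isomorphic; (ii) for every finite p-group Q, the F_p[Out(Q)]-modules F_p K(Q,G₁) and F_p K(Q,G₂) are isomorphic, where K(Q,G) ⊆ Inj(Q,G) is the set of classes of injective homomorphisms α : Q → G such that the order of C_G(Im α)/Z(Im α) is prime to p. -/

import Mathlib

/-- The subgroup of inner automorphisms of `Q`. -/
def Inn (Q : Type) [Group Q] : Subgroup (MulAut Q) := (MulAut.conj (G := Q)).range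

instance Inn.normal (Q : Type) [Group Q] : (Inn Q).Normal := by
  constructor
  rintro - ⟨q, rfl⟩ g
  refine ⟨g q, ?_⟩
  ext x
  simp [MulAut.conj_apply, map_mul, map_inv]

/-- The outer automorphism group `Out Q = Aut(Q)/Inn(Q)`. -/
def Out (Q : Type) [Group Q] : Type := MulAut Q ⧸ Inn Q

instance (Q : Type) [Group Q] : Group (Out Q) := QuotientGroup.Quotient.group _

/-- Two homomorphisms `Q → G` are identified in `Rep(Q,G)` iff they are conjugate in `G`. -/
instance homConjSetoid (Q G : Type) [Group Q] [Group G] : Setoid (Q →* G) where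
  r f g := ∃ x : G, ∀ q, g q = x⁻¹ * f q * x
  iseqv := by
    refine ⟨fun f => ⟨1, by simp⟩, ?_, ?_⟩
    · rintro f g ⟨x, hx⟩
      exact ⟨x⁻¹, fun q => by simp [hx q, mul_assoc]⟩
    · rintro f g h ⟨x, hx⟩ ⟨y, hy⟩
      exact ⟨x * y, fun q => by simp [hx q, hy q, mul_assoc]⟩

/-- `Rep(Q,G) = Hom(Q,G)/G`: conjugacy classes of homomorphisms `Q → G`. -/
def RepCl (Q G : Type) [Group Q] [Group G] : Type := Quotient (homConjSetoid Q G)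

/-- `Out Q` acts on `Rep(Q,G)` by precomposition: `[α] • [f] = [f ∘ α⁻¹]`. -/
instance (Q G : Type) [Group Q] [Group G] : SMul (Out Q) (RepCl Q G) where
  smul o c :=
    Quotient.liftOn' o
      (fun α : MulAut Q =>
        Quotient.map (fun f : Q →* G => f.comp (α⁻¹ : MulAut Q).toMonoidHom)
          (by rintro f g ⟨x, hx⟩; exact ⟨x, fun q => hx _⟩) c)
      (by
        rintro α β h
        rw [QuotientGroup.leftRel_apply] at h
        obtain ⟨q, hq⟩ := h
        induction c using Quotient.inductionOn with
        | h f =>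
          apply Quotient.sound
          refine ⟨f q, fun z => ?_⟩
          have hβ : β⁻¹ = (MulAut.conj q)⁻¹ * α⁻¹ := by
            rw [hq]; group
          simp only [MonoidHom.comp_apply, MulEquiv.coe_toMonoidHom, hβ]
          have : ((MulAut.conj q)⁻¹ * α⁻¹) z = q⁻¹ * (α⁻¹ z) * q := by
            simp [MulAut.conj_inv_apply]
          rw [this]
          simp [map_mul, map_inv])

instance (Q G : Type) [Group Q] [Group G] : MulAction (Out Q) (RepCl Q G) where
  one_smul c := by
    induction c using Quotient.inductionOn with
    | h f => apply Quotient.sound; exact ⟨1, fun q => by simp [MonoidHom.comp_apply]⟩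
  mul_smul o₁ o₂ c := by
    induction o₁ using Quotient.inductionOn' with
    | h α =>
      induction o₂ using Quotient.inductionOn' with
      | h β =>
        induction c using Quotient.inductionOn with
        | h f =>
          apply Quotient.sound
          exact ⟨1, fun q => by simp [MonoidHom.comp_apply, mul_inv_rev]⟩

/-- A class in `Rep(Q,G)` lies in `Inj(Q,G)` iff it is the class of an injective homomorphism. -/
def IsInjClass {Q G : Type} [Group Q] [Group G] (c : RepCl Q G) : Prop :=
  ∃ f : Q →* G, Function.Injective f ∧ (⟦f⟧ : RepCl Q G) = c

/-- `Inj(Q,G) ⊆ Rep(Q,G)`: classes of injective homomorphisms. -/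
def InjCl (Q G : Type) [Group Q] [Group G] : Type := {c : RepCl Q G // IsInjClass c}

instance (Q G : Type) [Group Q] [Group G] : SMul (Out Q) (InjCl Q G) where
  smul o c := ⟨o • c.1, by
    obtain ⟨c₁, f, hf, rfl⟩ := c
    induction o using Quotient.inductionOn' with
    | h α =>
      exact ⟨f.comp (α⁻¹ : MulAut Q).toMonoidHom,
        hf.comp (α⁻¹ : MulAut Q).injective, rfl⟩⟩

instance (Q G : Type) [Group Q] [Group G] : MulAction (Out Q) (InjCl Q G) where
  one_smul c := Subtype.ext (one_smul _ c.1)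
  mul_smul o₁ o₂ c := Subtype.ext (mul_smul o₁ o₂ c.1)

/-- The condition defining `K(Q,G)`: the quotient `C_G(Im f)/Z(Im f)` of the centralizer of the
image by the center of the image is a `p'`-group, i.e. its order is prime to `p`. -/
def KCond (p : ℕ) {Q G : Type} [Group Q] [Group G] (f : Q →* G) : Prop :=
  Nat.Coprime
    (Nat.card (Subgroup.centralizer (f.range : Set G)) /
      Nat.card (f.range ⊓ Subgroup.centralizer (f.range : Set G) : Subgroup G)) p

/-- A class in `Rep(Q,G)` lies in `K(Q,G)` iff it is the class of an injective homomorphism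
`f` with `C_G(Im f)/Z(Im f)` a `p'`-group. -/
def IsKClass (p : ℕ) {Q G : Type} [Group Q] [Group G] (c : RepCl Q G) : Prop :=
  ∃ f : Q →* G, Function.Injective f ∧ KCond p f ∧ (⟦f⟧ : RepCl Q G) = c

/-- `K(Q,G) ⊆ Inj(Q,G)`. -/
def KCl (p : ℕ) (Q G : Type) [Group Q] [Group G] : Type :=
  {c : RepCl Q G // IsKClass p c}

instance (p : ℕ) (Q G : Type) [Group Q] [Group G] : SMul (Out Q) (KCl p Q G) where
  smul o c := ⟨o • c.1, by
    obtain ⟨c₁, f, hf, hK, rfl⟩ := c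
    induction o using Quotient.inductionOn' with
    | h α =>
      refine ⟨f.comp (α⁻¹ : MulAut Q).toMonoidHom,
        hf.comp (α⁻¹ : MulAut Q).injective, ?_, rfl⟩
      have hr : (f.comp (α⁻¹ : MulAut Q).toMonoidHom).range = f.range := by
        rw [MonoidHom.range_comp]
        have : ((α⁻¹ : MulAut Q).toMonoidHom).range = (⊤ : Subgroup Q) :=
          MonoidHom.range_eq_top_of_surjective _ (α⁻¹ : MulAut Q).surjective
        rw [this, ← MonoidHom.range_eq_map]
      unfold KCond
      rw [hr]
      exact hK⟩

instance (p : ℕ) (Q G : Type) [Group Q] [Group G] : MulAction (Out Q) (KCl p Q G) where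
  one_smul c := Subtype.ext (one_smul _ c.1)
  mul_smul o₁ o₂ c := Subtype.ext (mul_smul o₁ o₂ c.1)

universe u

section Cancellation

variable {R : Type*} [Ring R]

/-- Homomorphisms with kernel `K` are the same as injective homomorphisms out of the quotient. -/
noncomputable def kerEqEquivQuotient {X A : Type*} [AddCommGroup X] [Module R X]
    [AddCommGroup A] [Module R A] (K : Submodule R X) :
    {f : X →ₗ[R] A // LinearMap.ker f = K} ≃ {g : X ⧸ K →ₗ[R] A // LinearMap.ker g = ⊥} where
  toFun f := ⟨K.liftQ f.1 f.2.ge, Submodule.ker_liftQ_eq_bot _ _ _ f.2.le⟩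
  invFun g := ⟨g.1 ∘ₗ K.mkQ, by rw [LinearMap.ker_comp, g.2, Submodule.comap_bot, K.ker_mkQ]⟩
  left_inv f := by ext x; simp
  right_inv g := by
    apply Subtype.ext
    apply Submodule.linearMap_qext
    ext x; simp

/-- If two finite modules receive equally many homomorphisms from every finite module, then they
receive equally many injective ones. -/
theorem card_ker_eq_bot_of_card_hom {A B : Type*} [AddCommGroup A] [Module R A] [Finite A]
    [AddCommGroup B] [Module R B] [Finite B]
    (h : ∀ (X : Type u) [AddCommGroup X] [Module R X] [Finite X],
      Nat.card (X →ₗ[R] A) = Nat.card (X →ₗ[R] B))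
    (X : Type u) [AddCommGroup X] [Module R X] [Finite X] :
    Nat.card {f : X →ₗ[R] A // LinearMap.ker f = ⊥} =
      Nat.card {f : X →ₗ[R] B // LinearMap.ker f = ⊥} := by
  induction hn : Nat.card X using Nat.strong_induction_on generalizing X with
  | _ n ih =>
    classical
    have : Finite (Submodule R X) := Finite.of_injective _ SetLike.coe_injective
    have : Fintype (Submodule R X) := Fintype.ofFinite _
    have : Finite (X →ₗ[R] A) := Finite.of_injective _ DFunLike.coe_injective
    have : Finite (X →ₗ[R] B) := Finite.of_injective _ DFunLike.coe_injective
    have key := h X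
    rw [← Nat.card_congr (Equiv.sigmaFiberEquiv fun f : X →ₗ[R] A => LinearMap.ker f),
      ← Nat.card_congr (Equiv.sigmaFiberEquiv fun f : X →ₗ[R] B => LinearMap.ker f),
      Nat.card_sigma, Nat.card_sigma, Fintype.sum_eq_add_sum_compl ⊥,
      Fintype.sum_eq_add_sum_compl (⊥ : Submodule R X)] at key
    refine Nat.add_right_cancel (key.trans (congrArg _ (Finset.sum_congr rfl fun K hK => ?_)).symm)
    rw [Nat.card_congr (kerEqEquivQuotient K), Nat.card_congr (kerEqEquivQuotient K)]
    have : Finite (X ⧸ K) := Finite.of_surjective _ K.mkQ_surjective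
    refine ih (Nat.card (X ⧸ K)) ?_ (X ⧸ K) rfl
    rw [← hn, Submodule.card_eq_card_quotient_mul_card K]
    have hK' : K ≠ ⊥ := by simpa using hK
    have : 1 < Nat.card K := by
      have := (Submodule.nontrivial_iff_ne_bot).2 hK'
      exact Finite.one_lt_card
    exact lt_mul_of_one_lt_left (Nat.card_pos (α := X ⧸ K)) this

/-- Finite modules with equally many homomorphisms from every finite module are isomorphic. -/
theorem nonempty_linearEquiv_of_card_hom {A B : Type u} [AddCommGroup A] [Module R A] [Finite A]
    [AddCommGroup B] [Module R B] [Finite B]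
    (h : ∀ (X : Type u) [AddCommGroup X] [Module R X] [Finite X],
      Nat.card (X →ₗ[R] A) = Nat.card (X →ₗ[R] B)) : Nonempty (A ≃ₗ[R] B) := by
  have h₁ := card_ker_eq_bot_of_card_hom h A
  have h₂ := card_ker_eq_bot_of_card_hom h B
  have : Finite (A →ₗ[R] A) := Finite.of_injective _ DFunLike.coe_injective
  have : Finite (A →ₗ[R] B) := Finite.of_injective _ DFunLike.coe_injective
  have : Finite (B →ₗ[R] B) := Finite.of_injective _ DFunLike.coe_injective
  have : Finite (B →ₗ[R] A) := Finite.of_injective _ DFunLike.coe_injective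
  have : Nonempty {f : A →ₗ[R] A // LinearMap.ker f = ⊥} := ⟨⟨.id, LinearMap.ker_id⟩⟩
  have : Nonempty {f : B →ₗ[R] B // LinearMap.ker f = ⊥} := ⟨⟨.id, LinearMap.ker_id⟩⟩
  obtain ⟨f, hf⟩ := (Nat.card_pos_iff.1 (h₁ ▸ Nat.card_pos)).1
  obtain ⟨g, hg⟩ := (Nat.card_pos_iff.1 (h₂.symm ▸ Nat.card_pos)).1
  rw [LinearMap.ker_eq_bot] at hf hg
  have hcard : Nat.card A = Nat.card B :=
    le_antisymm (Nat.card_le_card_of_injective f hf) (Nat.card_le_card_of_injective g hg)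
  exact ⟨LinearEquiv.ofBijective f ((Nat.bijective_iff_injective_and_card f).2 ⟨hf, hcard⟩)⟩

/-- Cancellation of a direct factor for finite modules. -/
theorem nonempty_linearEquiv_of_prod {A B C D : Type u} [AddCommGroup A] [Module R A] [Finite A]
    [AddCommGroup B] [Module R B] [Finite B] [AddCommGroup C] [Module R C] [Finite C]
    [AddCommGroup D] [Module R D] (e : (A × C) ≃ₗ[R] (B × D)) (e' : C ≃ₗ[R] D) :
    Nonempty (A ≃ₗ[R] B) := by
  refine nonempty_linearEquiv_of_card_hom fun X _ _ _ => ?_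
  have : Finite (X →ₗ[R] C) := Finite.of_injective _ DFunLike.coe_injective
  let e'' : (A × C) ≃ₗ[R] (B × C) := e.trans ((LinearEquiv.refl R B).prodCongr e'.symm)
  have h : Nat.card (X →ₗ[R] A × C) = Nat.card (X →ₗ[R] B × C) :=
    Nat.card_congr
      { toFun := fun f => e''.toLinearMap ∘ₗ f
        invFun := fun f => e''.symm.toLinearMap ∘ₗ f
        left_inv := fun f => by ext x <;> simp
        right_inv := fun f => by ext x <;> simp }
  rw [← Nat.card_congr (LinearMap.prodEquiv ℕ (M := X)).toEquiv,
    ← Nat.card_congr (LinearMap.prodEquiv ℕ (M := X)).toEquiv, Nat.card_prod, Nat.card_prod] at h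
  exact Nat.eq_of_mul_eq_mul_right Nat.card_pos h

end Cancellation

section Permutation

open scoped MonoidAlgebra

variable (k : Type) [CommRing k] (H : Type) [Group H]

/-- Two `H`-sets have isomorphic permutation modules, phrased with modules of functions. -/
def PermIso (X Y : Type) [MulAction H X] [MulAction H Y] : Prop :=
  ∃ e : (X → k) ≃ₗ[k] (Y → k), ∀ (h : H) (f : X → k),
    e (fun x => f (h • x)) = fun y => e f (h • y)

/-- The permutation representation on functions on an `H`-set. -/
def funRep (X : Type) [MulAction H X] : Representation k H (X → k) where
  toFun h := LinearMap.funLeft k k (fun x => h⁻¹ • x)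
  map_one' := by ext; simp [LinearMap.funLeft]
  map_mul' a b := by ext f x; simp [LinearMap.funLeft, mul_smul]

variable {k H} {X Y X' Y' : Type} [MulAction H X] [MulAction H Y] [MulAction H X'] [MulAction H Y']

@[simp]
theorem funRep_apply (h : H) (f : X → k) (x : X) : funRep k H X h f x = f (h⁻¹ • x) := rfl

theorem permIso_iff_equiv : PermIso k H X Y ↔ Nonempty ((funRep k H X).Equiv (funRep k H Y)) := by
  constructor
  · rintro ⟨e, he⟩
    refine ⟨Representation.Equiv.mk e fun h => ?_⟩
    refine LinearMap.ext fun f => funext fun y => ?_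
    exact congrFun (he h⁻¹ _) y
  · rintro ⟨e⟩
    refine ⟨e.toLinearEquiv, fun h f => ?_⟩
    have := LinearMap.congr_fun (e.isIntertwining' h⁻¹) f
    ext y
    have := congrFun this y
    have h2 : funRep k H X h⁻¹ f = fun x => f (h • x) := by ext; simp
    simpa [h2] using! this

/-- For a finite `H`-set, functions form the free module with its permutation action. -/
noncomputable def funRepEquiv [Finite X] :
    (Representation.ofMulAction k H X).Equiv (funRep k H X) :=
  Representation.Equiv.mk
    ((MonoidAlgebra.coeffLinearEquiv k).trans (Finsupp.linearEquivFunOnFinite k k X)) fun h => by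
      refine LinearMap.ext fun f => funext fun x => ?_
      exact Representation.coeff_ofMulAction h f x

theorem permIso_iff_rep [Finite X] [Finite Y] :
    Nonempty (Rep.ofMulAction k H X ≅ Rep.ofMulAction k H Y) ↔ PermIso k H X Y := by
  rw [permIso_iff_equiv]
  constructor
  · rintro ⟨e⟩
    exact ⟨funRepEquiv.symm.trans ((Representation.equivOfIso e).trans funRepEquiv)⟩
  · rintro ⟨e⟩
    exact ⟨Rep.mkIso (funRepEquiv.trans (e.trans funRepEquiv.symm))⟩

theorem PermIso.symm (h : PermIso k H X Y) : PermIso k H Y X := by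
  rw [permIso_iff_equiv] at *
  exact h.map fun e => e.symm

theorem PermIso.trans (h : PermIso k H X Y) (h' : PermIso k H Y X') : PermIso k H X X' := by
  rw [permIso_iff_equiv] at *
  obtain ⟨e⟩ := h
  exact h'.map fun e' => e.trans e'

theorem PermIso.of_equiv (e : X ≃ Y) (he : ∀ (h : H) x, e (h • x) = h • e x) :
    PermIso k H X Y :=
  ⟨LinearEquiv.funCongrLeft k k e.symm, fun h f => by
    ext y
    have : e.symm (h • y) = h • e.symm y := by rw [Equiv.symm_apply_eq, he, e.apply_symm_apply]
    simp [LinearMap.funLeft, this]⟩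

/-- The fibre of an invariant map, as an `H`-set. -/
def fiberAction {τ : Type*} (a : X → τ) (ha : ∀ (h : H) x, a (h • x) = a x) (t : τ) :
    SubMulAction H X where
  carrier := {x | a x = t}
  smul_mem' h _ hx := (ha h _).trans hx

/-- Isomorphisms of permutation modules over the fibres of invariant maps glue. -/
theorem PermIso.of_fibers {τ : Type*} (a : X → τ) (b : Y → τ) (ha : ∀ (h : H) x, a (h • x) = a x)
    (hb : ∀ (h : H) y, b (h • y) = b y)
    (h : ∀ t, PermIso k H (fiberAction a ha t) (fiberAction b hb t)) :
    PermIso k H X Y := by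
  choose e he using h
  refine ⟨LinearEquiv.ofLinearMap
    { toFun := fun f y => e (b y) (fun x => f x.1) ⟨y, rfl⟩
      map_add' := fun f g => by ext y; exact congrFun (map_add (e (b y)) _ _) _
      map_smul' := fun c f => by ext y; exact congrFun (map_smul (e (b y)) c _) _ }
    { toFun := fun f x => (e (a x)).symm (fun y => f y.1) ⟨x, rfl⟩
      map_add' := fun f g => by ext y; exact congrFun (map_add (e (a y)).symm _ _) _
      map_smul' := fun c f => by ext y; exact congrFun (map_smul (e (a y)).symm c _) _ }
      ?_ ?_, ?_⟩
  · refine LinearMap.ext fun f => funext fun y => ?_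
    have h2 : (fun x : fiberAction a ha (b y) =>
        (e (a x.1)).symm (fun y => f y.1) ⟨x.1, rfl⟩) = (e (b y)).symm fun y => f y.1 := by
      funext ⟨x, hx⟩
      obtain hx : a x = b y := hx
      generalize b y = t at hx
      subst hx
      rfl
    change e (b y) (fun x => (e (a x.1)).symm (fun y => f y.1) ⟨x.1, rfl⟩) ⟨y, rfl⟩ = f y
    rw [h2, LinearEquiv.apply_symm_apply]
  · refine LinearMap.ext fun f => funext fun x => ?_
    have h2 : (fun y : fiberAction b hb (a x) =>
        e (b y.1) (fun x => f x.1) ⟨y.1, rfl⟩) = e (a x) fun x => f x.1 := by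
      funext ⟨y, hy⟩
      obtain hy : b y = a x := hy
      generalize a x = t at hy
      subst hy
      rfl
    change (e (a x)).symm (fun y => e (b y.1) (fun x => f x.1) ⟨y.1, rfl⟩) ⟨x, rfl⟩ = f x
    rw [h2, LinearEquiv.symm_apply_apply]
  · intro h f
    funext y
    change e (b y) (fun x => f (h • x.1)) ⟨y, rfl⟩ =
      e (b (h • y)) (fun x => f x.1) ⟨h • y, rfl⟩
    have h1 := congrFun (he (b y) h fun x => f x.1) ⟨y, rfl⟩
    refine h1.trans ?_
    have h2 (t : τ) (ht : b (h • y) = t) : e t (fun x => f x.1) ⟨h • y, ht⟩ =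
        e (b (h • y)) (fun x => f x.1) ⟨h • y, rfl⟩ := by
      subst ht
      rfl
    exact h2 _ (hb h y)

/-- Permutation modules of disjoint unions. -/
theorem PermIso.sum (h : PermIso k H X Y) (h' : PermIso k H X' Y') :
    PermIso k H (X ⊕ X') (Y ⊕ Y') := by
  obtain ⟨e, he⟩ := h
  obtain ⟨e', he'⟩ := h'
  refine ⟨(LinearEquiv.sumArrowLequivProdArrow X X' k k).trans
    ((e.prodCongr e').trans (LinearEquiv.sumArrowLequivProdArrow Y Y' k k).symm), fun h f => ?_⟩
  ext (y | y)
  · exact congrFun (he h fun x => f (.inl x)) y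
  · exact congrFun (he' h fun x => f (.inr x)) y

theorem permIso_iff_asModule :
    PermIso k H X Y ↔ Nonempty ((funRep k H X).asModule ≃ₗ[k[H]] (funRep k H Y).asModule) := by
  rw [permIso_iff_equiv]
  constructor
  · rintro ⟨e⟩
    exact ⟨LinearEquiv.ofBijective
      (Representation.IntertwiningMap.equivLinearMapAsModule _ _ e.toIntertwiningMap)
      e.toLinearEquiv.bijective⟩
  · rintro ⟨e⟩
    let φ := (Representation.IntertwiningMap.equivLinearMapAsModule _ _).symm e.toLinearMap
    exact ⟨Representation.Equiv.mk (LinearEquiv.ofBijective φ.toLinearMap e.bijective)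
      φ.isIntertwining'⟩

/-- The permutation module of a disjoint union is the direct sum of the permutation modules. -/
theorem nonempty_asModule_sum_equiv :
    Nonempty ((funRep k H (X ⊕ X')).asModule ≃ₗ[k[H]]
      ((funRep k H X).asModule × (funRep k H X').asModule)) := by
  let φ : (funRep k H (X ⊕ X')).IntertwiningMap (funRep k H X) :=
    ⟨LinearMap.funLeft k k Sum.inl, fun _ => rfl⟩
  let ψ : (funRep k H (X ⊕ X')).IntertwiningMap (funRep k H X') :=
    ⟨LinearMap.funLeft k k Sum.inr, fun _ => rfl⟩
  exact ⟨LinearEquiv.ofBijective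
    ((Representation.IntertwiningMap.equivLinearMapAsModule _ _ φ).prod
      (Representation.IntertwiningMap.equivLinearMapAsModule _ _ ψ))
    (LinearEquiv.sumArrowLequivProdArrow X X' k k).bijective⟩

/-- Cancellation of permutation modules over a finite ring. -/
theorem PermIso.of_sum [Finite k] [Finite X] [Finite Y] [Finite X'] [Finite Y']
    (h : PermIso k H (X ⊕ X') (Y ⊕ Y')) (h' : PermIso k H X' Y') : PermIso k H X Y := by
  rw [permIso_iff_asModule] at *
  obtain ⟨e⟩ := h
  obtain ⟨e'⟩ := h'
  obtain ⟨s⟩ := nonempty_asModule_sum_equiv (k := k) (H := H) (X := X) (X' := X')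
  obtain ⟨t⟩ := nonempty_asModule_sum_equiv (k := k) (H := H) (X := Y) (X' := Y')
  have : Finite (funRep k H X).asModule := inferInstanceAs (Finite (X → k))
  have : Finite (funRep k H Y).asModule := inferInstanceAs (Finite (Y → k))
  have : Finite (funRep k H X').asModule := inferInstanceAs (Finite (X' → k))
  exact nonempty_linearEquiv_of_prod (s.symm.trans (e.trans t)) e'

end Permutation

section Trace

variable (p : ℕ) {H L X Y Z W : Type} [Group H] [Group L] [MulAction H X] [MulAction L X]
  [MulAction H Y] [MulAction L Y] [MulAction L Z] [MulAction L W]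

variable (H) in
/-- A point whose stabilizer has order prime to `p`. -/
def IsReg (x : X) : Prop := ¬ p ∣ Nat.card (MulAction.stabilizer H x)

theorem isReg_smul_iff (h : H) (x : X) : IsReg p H (h • x) ↔ IsReg p H x := by
  rw [IsReg, IsReg, ← Nat.card_congr
    (MulAction.stabilizerEquivStabilizer (g := h) (a := x) (b := h • x) rfl).toEquiv]

theorem isReg_smul_iff_of_comm [SMulCommClass L H X] (l : L) (x : X) :
    IsReg p H (l • x) ↔ IsReg p H x := by
  have : MulAction.stabilizer H (l • x) = MulAction.stabilizer H x := by
    ext h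
    simp [MulAction.mem_stabilizer_iff, ← smul_comm l h]
  rw [IsReg, IsReg, this]

/-- `π` presents `Z` as the set of `H`-orbits of points of `X` with stabilizer of order prime
to `p`, compatibly with the actions of `L`. -/
structure IsRegQuotient [SMulCommClass L H X] (π : {x : X // IsReg p H x} → Z) : Prop where
  surjective : Function.Surjective π
  eq_iff : ∀ x y : {x : X // IsReg p H x}, π x = π y ↔ ∃ h : H, h • x.1 = y.1
  map_smul : ∀ (l : L) (x : {x : X // IsReg p H x}),
    π ⟨l • x.1, (isReg_smul_iff_of_comm p l x.1).2 x.2⟩ = l • π x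

theorem card_smul_eq [Finite H] (x y : X) : Nat.card {h : H // h • x = y} = 0 ∨
    Nat.card {h : H // h • x = y} = Nat.card (MulAction.stabilizer H x) := by
  rcases isEmpty_or_nonempty {h : H // h • x = y} with hE | ⟨⟨h₀, h₀y⟩⟩
  · exact Or.inl Nat.card_of_isEmpty
  · right
    subst h₀y
    refine Nat.card_congr ((Equiv.mulLeft h₀⁻¹).subtypeEquiv fun h => ?_)
    simp [MulAction.mem_stabilizer_iff, mul_smul, inv_smul_eq_iff]

variable (H) in
/-- The trace map on functions. -/
noncomputable def traceMap [Fintype H] : (X → ZMod p) →ₗ[ZMod p] (X → ZMod p) where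
  toFun f x := ∑ h : H, f (h • x)
  map_add' f g := by ext; simp [Finset.sum_add_distrib]
  map_smul' c f := by ext; simp [Finset.mul_sum]

open Classical in
/-- Functions on the quotient, extended by zero to all points. -/
noncomputable def pullMap (π : {x : X // IsReg p H x} → Z) :
    (Z → ZMod p) →ₗ[ZMod p] (X → ZMod p) where
  toFun f x := if h : IsReg p H x then f (π ⟨x, h⟩) else 0
  map_add' f g := by ext x; by_cases h : IsReg p H x <;> simp [h]
  map_smul' c f := by ext x; by_cases h : IsReg p H x <;> simp [h]

variable {p}

theorem traceMap_apply [Fintype H] (f : X → ZMod p) (x : X) :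
    traceMap p H f x = ∑ h : H, f (h • x) := rfl

theorem traceMap_smul [Fintype H] (f : X → ZMod p) (h : H) (x : X) :
    traceMap p H f (h • x) = traceMap p H f x := by
  rw [traceMap_apply, traceMap_apply, ← Equiv.sum_comp (Equiv.mulRight h) fun g => f (g • x)]
  simp [mul_smul]

theorem traceMap_eq_sum [Fintype H] [Fintype X] (f : X → ZMod p) (x : X) :
    traceMap p H f x = ∑ y, Nat.card {h : H // h • x = y} * f y := by
  classical
  rw [traceMap_apply, ← Finset.sum_fiberwise _ (fun h : H => h • x)]
  refine Finset.sum_congr rfl fun y _ => ?_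
  rw [Finset.sum_congr rfl fun h hh => by rw [(Finset.mem_filter.1 hh).2], Finset.sum_const,
    nsmul_eq_mul, Nat.card_eq_fintype_card, Fintype.card_subtype]

theorem traceMap_eq_zero [Fintype H] [Finite X] (f : X → ZMod p) {x : X} (hx : ¬ IsReg p H x) :
    traceMap p H f x = 0 := by
  have := Fintype.ofFinite X
  rw [traceMap_eq_sum]
  refine Finset.sum_eq_zero fun y _ => ?_
  rw [IsReg, not_not] at hx
  rcases card_smul_eq (H := H) x y with h | h
  · simp [h]
  · rw [h, (ZMod.natCast_eq_zero_iff _ _).2 hx, zero_mul]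

theorem pullMap_of_isReg (π : {x : X // IsReg p H x} → Z) (f : Z → ZMod p) (x)
    (h : IsReg p H x) : pullMap p π f x = f (π ⟨x, h⟩) := dif_pos h

theorem pullMap_of_not_isReg (π : {x : X // IsReg p H x} → Z) (f : Z → ZMod p) (x)
    (h : ¬ IsReg p H x) : pullMap p π f x = 0 := dif_neg h

variable [SMulCommClass L H X] [SMulCommClass L H Y] {π : {x : X // IsReg p H x} → Z}
  {π' : {x : Y // IsReg p H x} → W}

theorem IsRegQuotient.pullMap_injective (hπ : IsRegQuotient (L := L) p π) :
    Function.Injective (pullMap p π) := by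
  intro f g hfg
  ext z
  obtain ⟨⟨x, hx⟩, rfl⟩ := hπ.surjective z
  simpa [pullMap_of_isReg π _ x hx] using congrFun hfg x

theorem IsRegQuotient.range_pullMap [Fact p.Prime] [Fintype H] [Finite X]
    (hπ : IsRegQuotient (L := L) p π) :
    LinearMap.range (pullMap p π) = LinearMap.range (traceMap p H) := by
  classical
  have := Fintype.ofFinite X
  obtain ⟨s, hs⟩ := hπ.surjective.hasRightInverse
  apply le_antisymm
  · rintro - ⟨f, rfl⟩
    refine ⟨fun x => if h : IsReg p H x then if (s (π ⟨x, h⟩)).1 = x then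
      (Nat.card (MulAction.stabilizer H x) : ZMod p)⁻¹ * f (π ⟨x, h⟩) else 0 else 0, ?_⟩
    ext x
    by_cases hx : IsReg p H x
    · rw [pullMap_of_isReg π f x hx, traceMap_eq_sum]
      have hsx := (hπ.eq_iff ⟨x, hx⟩ (s (π ⟨x, hx⟩))).1 (hs _).symm
      rw [Finset.sum_eq_single (s (π ⟨x, hx⟩)).1]
      · have hne : (Nat.card (MulAction.stabilizer H x) : ZMod p) ≠ 0 := by
          rwa [Ne, ZMod.natCast_eq_zero_iff]
        have hst : Nat.card (MulAction.stabilizer H (s (π ⟨x, hx⟩)).1) =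
            Nat.card (MulAction.stabilizer H x) := by
          obtain ⟨h, hh⟩ := hsx
          exact Nat.card_congr (MulAction.stabilizerEquivStabilizer (g := h) hh.symm).toEquiv.symm
        have hc : Nat.card {h : H // h • x = (s (π ⟨x, hx⟩)).1} =
            Nat.card (MulAction.stabilizer H x) := by
          refine (card_smul_eq x _).resolve_left ?_
          have : Nonempty {h : H // h • x = (s (π ⟨x, hx⟩)).1} := ⟨⟨_, hsx.choose_spec⟩⟩
          exact Nat.card_pos.ne'
        rw [dif_pos (s (π ⟨x, hx⟩)).2, if_pos (by rw [Subtype.coe_eta, hs]), Subtype.coe_eta, hs,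
          hst, hc, mul_inv_cancel_left₀ hne]
      · intro y _ hy
        rcases isEmpty_or_nonempty {h : H // h • x = y} with hE | ⟨⟨h, rfl⟩⟩
        · simp
        · have hhx := (isReg_smul_iff p h x).2 hx
          have : π ⟨h • x, hhx⟩ = π ⟨x, hx⟩ := ((hπ.eq_iff ⟨x, hx⟩ ⟨h • x, hhx⟩).2 ⟨h, rfl⟩).symm
          rw [dif_pos hhx, if_neg, mul_zero]
          rw [this]
          exact fun h => hy h.symm
      · simp
    · rw [pullMap_of_not_isReg π f x hx, traceMap_eq_zero _ hx]
  · rintro - ⟨f, rfl⟩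
    refine ⟨fun z => traceMap p H f (s z).1, ?_⟩
    ext x
    by_cases hx : IsReg p H x
    · rw [pullMap_of_isReg π _ x hx]
      obtain ⟨h, hh⟩ := (hπ.eq_iff ⟨x, hx⟩ (s (π ⟨x, hx⟩))).1 (hs _).symm
      rw [← hh, traceMap_smul]
    · rw [pullMap_of_not_isReg π _ x hx, traceMap_eq_zero _ hx]

theorem IsRegQuotient.pullMap_smul (hπ : IsRegQuotient (L := L) p π) (l : L) (f : Z → ZMod p) :
    pullMap p π (fun z => f (l • z)) = fun x => pullMap p π f (l • x) := by
  ext x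
  by_cases hx : IsReg p H x
  · rw [pullMap_of_isReg π _ x hx,
      pullMap_of_isReg π _ _ ((isReg_smul_iff_of_comm p l x).2 hx), hπ.map_smul l ⟨x, hx⟩]
  · rw [pullMap_of_not_isReg π _ x hx,
      pullMap_of_not_isReg π _ _ (mt (isReg_smul_iff_of_comm p l x).1 hx)]

/-- An isomorphism of permutation modules commuting with `H` and `L` induces an isomorphism of
the permutation modules of `L` on the orbits of `H` with stabilizer of order prime to `p`. -/
theorem IsRegQuotient.permIso [Fact p.Prime] [Finite H] [Finite X] [Finite Y]
    (hπ : IsRegQuotient (L := L) p π) (hπ' : IsRegQuotient (L := L) p π')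
    (e : (X → ZMod p) ≃ₗ[ZMod p] (Y → ZMod p))
    (heH : ∀ (h : H) (f : X → ZMod p), e (fun x => f (h • x)) = fun y => e f (h • y))
    (heL : ∀ (l : L) (f : X → ZMod p), e (fun x => f (l • x)) = fun y => e f (l • y)) :
    PermIso (ZMod p) L Z W := by
  have := Fintype.ofFinite H
  have htr (f : X → ZMod p) : e (traceMap p H f) = traceMap p H (e f) := by
    have : traceMap p H f = ∑ h : H, fun x => f (h • x) := by
      ext x; simp [traceMap_apply]
    rw [this, map_sum]
    ext y
    simp [traceMap_apply, heH]
  have hmap : (LinearMap.range (pullMap p π)).map e.toLinearMap =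
      LinearMap.range (pullMap p π') := by
    rw [hπ.range_pullMap, hπ'.range_pullMap, ← LinearMap.range_comp,
      ← LinearMap.range_comp_of_range_eq_top (traceMap p H) e.range]
    congr 1
    exact LinearMap.ext htr
  let E := (LinearEquiv.ofInjective (pullMap p π) hπ.pullMap_injective).trans
    ((e.ofSubmodules _ _ hmap).trans
      (LinearEquiv.ofInjective (pullMap p π') hπ'.pullMap_injective).symm)
  have hE (f) : pullMap p π' (E f) = e (pullMap p π f) := by
    have := LinearEquiv.apply_symm_apply
      (LinearEquiv.ofInjective (pullMap p π') hπ'.pullMap_injective)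
      (e.ofSubmodules _ _ hmap (LinearEquiv.ofInjective (pullMap p π) hπ.pullMap_injective f))
    exact congrArg Subtype.val this
  refine ⟨E, fun l f => hπ'.pullMap_injective ?_⟩
  rw [hE, hπ.pullMap_smul, heL, hπ'.pullMap_smul, hE]

end Trace

section PSubgroups

variable {p : ℕ} {G : Type} [Group G]

/-- `S` contains every `p`-element of `C` normalizing it. -/
def IsNormalizerMaximal (p : ℕ) (C S : Subgroup G) : Prop :=
  ∀ t ∈ C, (∃ n : ℕ, t ^ p ^ n = 1) → (∀ s ∈ S, t * s * t⁻¹ ∈ S) → t ∈ S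

theorem mem_normalizer_of_conj_mem [Finite G] {S : Subgroup G} {t : G}
    (h : ∀ s ∈ S, t * s * t⁻¹ ∈ S) : t ∈ Subgroup.normalizer (S : Set G) := by
  have hle : S.map (MulAut.conj t).toMonoidHom ≤ S := by
    rintro - ⟨s, hs, rfl⟩
    exact h s hs
  have heq : S.map (MulAut.conj t).toMonoidHom = S :=
    Subgroup.eq_of_le_of_card_ge hle
      (Nat.card_congr (S.equivMapOfInjective _ (MulAut.conj t).injective).toEquiv).le
  rw [Subgroup.mem_normalizer_iff]
  refine fun s => ⟨h s, fun hs => ?_⟩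
  have hs' : t * s * t⁻¹ ∈ S.map (MulAut.conj t).toMonoidHom := heq.symm ▸ hs
  obtain ⟨s', hs', e⟩ := hs'
  have : s' = s := by simpa using e
  exact this ▸ hs'

theorem Sylow.isNormalizerMaximal [Finite G] [Fact p.Prime] {C : Subgroup G} (T : Sylow p C) :
    IsNormalizerMaximal p C ((T : Subgroup C).map C.subtype) := by
  rintro t ht ⟨n, hn⟩ hS
  have hz : IsPGroup p (Subgroup.zpowers (⟨t, ht⟩ : C)) := by
    rw [IsPGroup.iff_card]
    obtain ⟨m, -, hm⟩ := (Nat.dvd_prime_pow (Fact.out : p.Prime)).1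
      (orderOf_dvd_of_pow_eq_one (x := (⟨t, ht⟩ : C)) (n := p ^ n) (Subtype.ext hn))
    exact ⟨m, by rw [Nat.card_zpowers, hm]⟩
  have hN : (⟨t, ht⟩ : C) ∈ Subgroup.normalizer ((T : Subgroup C) : Set C) := by
    refine mem_normalizer_of_conj_mem fun s hs => ?_
    obtain ⟨s', hs', e⟩ := hS s ⟨s, hs, rfl⟩
    have : s' = ⟨t, ht⟩ * s * ⟨t, ht⟩⁻¹ := Subtype.ext e
    exact this ▸ hs'
  have : (⟨t, ht⟩ : C) ∈ Subgroup.zpowers (⟨t, ht⟩ : C) ⊓ (T : Subgroup C) := by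
    rw [← hz.inf_normalizer_sylow T]
    exact ⟨Subgroup.mem_zpowers _, hN⟩
  exact ⟨_, this.2, rfl⟩

theorem IsNormalizerMaximal.exists_sylow [Finite G] [Fact p.Prime] {C S : Subgroup G} (hSC : S ≤ C)
    (hS : IsPGroup p S) (h : IsNormalizerMaximal p C S) :
    ∃ T : Sylow p C, (T : Subgroup C).map C.subtype = S := by
  have hS' : IsPGroup p (S.subgroupOf C) :=
    hS.of_equiv (Subgroup.subgroupOfEquivOfLe hSC).symm
  obtain ⟨T, hT⟩ := hS'.exists_le_sylow
  refine ⟨T, ?_⟩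
  have hST : S ≤ (T : Subgroup C).map C.subtype := fun s hs => ⟨⟨s, hSC hs⟩, hT hs, rfl⟩
  refine le_antisymm ?_ hST
  by_contra hne
  have hnil : Group.IsNilpotent T := T.isPGroup'.isNilpotent
  have hlt : (S.subgroupOf C).subgroupOf T < ⊤ := by
    rw [lt_top_iff_ne_top, Ne, Subgroup.subgroupOf_eq_top]
    intro hle
    apply hne
    rintro - ⟨t, ht, rfl⟩
    exact hle ht
  obtain ⟨-, ⟨⟨t, htC⟩, htT⟩, htN, htS⟩ := SetLike.lt_iff_le_and_exists.1
    (Group.normalizerCondition_of_isNilpotent _ hlt)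
  rw [Subgroup.mem_normalizer_iff] at htN
  refine htS (h t htC ?_ fun s hs => ?_)
  · obtain ⟨n, hn⟩ := T.isPGroup' ⟨⟨t, htC⟩, htT⟩
    exact ⟨n, congrArg (fun x : T => (x : G)) hn⟩
  · exact (htN ⟨⟨s, hSC hs⟩, hT hs⟩).1 hs

theorem IsNormalizerMaximal.exists_conj [Finite G] [Fact p.Prime] {C S S' : Subgroup G}
    (hSC : S ≤ C) (hS : IsPGroup p S) (h : IsNormalizerMaximal p C S) (hSC' : S' ≤ C)
    (hS' : IsPGroup p S') (h' : IsNormalizerMaximal p C S') :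
    ∃ c ∈ C, ∀ x, x ∈ S ↔ c * x * c⁻¹ ∈ S' := by
  obtain ⟨T, hT⟩ := h.exists_sylow hSC hS
  obtain ⟨T', hT'⟩ := h'.exists_sylow hSC' hS'
  obtain ⟨c, hc⟩ := MulAction.exists_smul_eq C T T'
  have key (x : C) : x ∈ (T : Subgroup C) ↔ c * x * c⁻¹ ∈ (T' : Subgroup C) := by
    rw [← hc, Sylow.coe_subgroup_smul, ← MulAut.conj_apply, ← MulAut.smul_def,
      Subgroup.smul_mem_pointwise_smul_iff]
  refine ⟨c, c.2, fun x => ⟨fun hx => ?_, fun hx => ?_⟩⟩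
  · rw [← hT] at hx
    obtain ⟨y, hy, rfl⟩ := hx
    rw [← hT']
    exact ⟨_, (key y).1 hy, rfl⟩
  · rw [← hT'] at hx
    obtain ⟨y, hy, e⟩ := hx
    have hxy : x = (c⁻¹ * y * c : C) := by
      have : (y : G) = c * x * (c : G)⁻¹ := e
      simp [this, mul_assoc]
    rw [← hT, hxy]
    have hc' : c * (c⁻¹ * y * c) * c⁻¹ = y := by group
    exact ⟨_, (key _).2 (hc'.symm ▸ hy), rfl⟩

/-- The centralizer of a homomorphism. -/
def homCent {Q : Type} [Group Q] (f : Q →* G) : Subgroup G := Subgroup.centralizer (f.range : Set G)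

theorem mem_homCent_iff {Q : Type} [Group Q] {f : Q →* G} {x : G} :
    x ∈ homCent f ↔ ∀ q, x * f q = f q * x := by
  simp [homCent, Subgroup.mem_centralizer_iff, eq_comm]

theorem kCond_iff {Q : Type} [Group Q] [Finite G] (hp : p.Prime) (f : Q →* G) :
    KCond p f ↔ ∀ u ∈ homCent f, (∃ n : ℕ, u ^ p ^ n = 1) → u ∈ f.range := by
  have := Fact.mk hp
  have hle : f.range ⊓ homCent f ≤ homCent f := inf_le_right
  have hidx : Nat.card (homCent f) / Nat.card (f.range ⊓ homCent f : Subgroup G) =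
      (f.range ⊓ homCent f).relIndex (homCent f) := by
    rw [← Subgroup.relIndex_bot_left (homCent f),
      ← Subgroup.relIndex_bot_left (f.range ⊓ homCent f),
      ← Subgroup.relIndex_mul_relIndex ⊥ _ _ bot_le hle, Subgroup.relIndex_bot_left,
      Nat.mul_comm, Nat.mul_div_cancel _ Nat.card_pos]
  have hK : KCond p f ↔ Nat.Coprime ((f.range ⊓ homCent f).relIndex (homCent f)) p := by
    rw [← hidx]; rfl
  rw [hK]
  constructor
  · rintro h u hu ⟨n, hn⟩
    have hN : ((f.range ⊓ homCent f).subgroupOf (homCent f)).Normal := by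
      constructor
      rintro ⟨n, hn⟩ ⟨⟨q, rfl⟩, -⟩ ⟨g, hg⟩
      refine ⟨⟨q, ?_⟩, ?_⟩
      · change f q = g * f q * g⁻¹
        rw [mem_homCent_iff.1 hg q, mul_inv_cancel_right]
      · exact (homCent f).mul_mem ((homCent f).mul_mem hg hn) ((homCent f).inv_mem hg)
    have hm : u ^ (f.range ⊓ homCent f).relIndex (homCent f) ∈ f.range :=
      (Subgroup.pow_index_mem ((f.range ⊓ homCent f).subgroupOf (homCent f)) ⟨u, hu⟩).1
    have hco : (orderOf u).Coprime ((f.range ⊓ homCent f).relIndex (homCent f)) :=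
      ((h.pow_right n).symm).coprime_dvd_left (orderOf_dvd_of_pow_eq_one hn)
    obtain ⟨m, hm'⟩ := exists_pow_eq_self_of_coprime hco.symm
    rw [← hm']
    exact Subgroup.pow_mem _ hm _
  · intro h
    obtain ⟨T⟩ : Nonempty (Sylow p (homCent f)) := inferInstance
    have hT : (T : Subgroup (homCent f)) ≤ (f.range ⊓ homCent f).subgroupOf (homCent f) := by
      rintro ⟨t, ht⟩ htT
      obtain ⟨n, hn⟩ := T.isPGroup' ⟨_, htT⟩
      exact ⟨h t ht ⟨n, congrArg (fun x : T => (x : G)) hn⟩, ht⟩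
    have := (Nat.Coprime.coprime_dvd_right (Subgroup.index_dvd_of_le hT)
      ((Nat.Prime.coprime_iff_not_dvd hp).2 T.not_dvd_index)).symm
    exact this

end PSubgroups

section Typing

variable {p : ℕ} {Q P P' G : Type} [Group Q] [Group P] [Group P'] [Group G]

/-- Injective homomorphisms whose image generates the target together with its centralizer. -/
structure IsCentric (i : Q →* P) : Prop where
  injective : Function.Injective i
  exists_eq_mul : ∀ y, ∃ q, ∃ s ∈ homCent i, y = i q * s

/-- The homomorphism `β` belongs to `K(P, G)`, and it maps the centralizer of the image of `i`
onto a maximal `p`-subgroup of the centralizer of the image of `β ∘ i`. -/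
structure IsTyping (p : ℕ) (β : P →* G) (i : Q →* P) : Prop where
  injective : Function.Injective β
  kCond : KCond p β
  isCentric : IsCentric i
  isNormalizerMaximal : IsNormalizerMaximal p (homCent (β.comp i)) ((homCent i).map β)

theorem map_homCent_le (β : P →* G) (i : Q →* P) : (homCent i).map β ≤ homCent (β.comp i) := by
  rintro - ⟨s, hs, rfl⟩
  rw [mem_homCent_iff]
  intro q
  simpa using congrArg β (mem_homCent_iff.1 hs q)

theorem mem_homCent_of_map_mem {β : P →* G} (hβ : Function.Injective β) {i : Q →* P} {s : P}
    (hs : β s ∈ homCent (β.comp i)) : s ∈ homCent i := by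
  rw [mem_homCent_iff] at *
  intro q
  apply hβ
  simpa using hs q

theorem exists_mulEquiv_of_range_eq {β : P →* G} {β' : P' →* G} (hβ : Function.Injective β)
    (hβ' : Function.Injective β') (h : β.range = β'.range) :
    ∃ φ : P ≃* P', ∀ y, β' (φ y) = β y := by
  refine ⟨(MonoidHom.ofInjective hβ).trans
    ((MulEquiv.subgroupCongr h).trans (MonoidHom.ofInjective hβ').symm), fun y => ?_⟩
  exact congrArg Subtype.val ((MonoidHom.ofInjective hβ').apply_symm_apply
    (MulEquiv.subgroupCongr h (MonoidHom.ofInjective hβ y)))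

theorem pow_prime_pow_conj (x t : G) (h : ∃ n : ℕ, t ^ p ^ n = 1) :
    ∃ n : ℕ, (x * t * x⁻¹) ^ p ^ n = 1 := by
  obtain ⟨n, hn⟩ := h
  exact ⟨n, by rw [conj_pow, hn, mul_one, mul_inv_cancel]⟩

theorem KCond.conj [Finite G] (hp : p.Prime) {f : Q →* G} (hf : KCond p f) (x : G) :
    KCond p ((MulAut.conj x).toMonoidHom.comp f) := by
  rw [kCond_iff hp] at *
  intro u hu hn
  have hu' : x⁻¹ * u * x ∈ homCent f := mem_homCent_iff.2 fun q => by
    have := congrArg (fun y => x⁻¹ * y * x) (mem_homCent_iff.1 hu q)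
    simpa [mul_assoc] using this
  obtain ⟨q, hq⟩ := hf _ hu' (by simpa using pow_prime_pow_conj x⁻¹ u hn)
  exact ⟨q, by simp [hq, mul_assoc]⟩

theorem IsTyping.conj [Finite G] (hp : p.Prime) {β : P →* G} {i : Q →* P} (h : IsTyping p β i)
    (x : G) : IsTyping p ((MulAut.conj x).toMonoidHom.comp β) i where
  injective := (MulAut.conj x).injective.comp h.injective
  kCond := h.kCond.conj hp x
  isCentric := h.isCentric
  isNormalizerMaximal := by
    intro t ht hn hS
    have ht' : x⁻¹ * t * x ∈ homCent (β.comp i) := mem_homCent_iff.2 fun q => by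
      have := congrArg (fun y => x⁻¹ * y * x) (mem_homCent_iff.1 ht q)
      simpa [mul_assoc] using this
    obtain ⟨s, hs, e⟩ := h.isNormalizerMaximal _ ht'
      (by simpa using pow_prime_pow_conj x⁻¹ t hn) (by
      rintro - ⟨s, hs, rfl⟩
      obtain ⟨s', hs', e⟩ := hS _ ⟨s, hs, rfl⟩
      refine ⟨s', hs', ?_⟩
      have := congrArg (fun y => x⁻¹ * y * x) e
      simpa [mul_assoc] using this)
    exact ⟨s, hs, by simp [e, mul_assoc]⟩

theorem IsCentric.congr {i : Q →* P} (h : IsCentric i) (e : P ≃* P') (ψ : Q ≃* Q) :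
    IsCentric (e.toMonoidHom.comp (i.comp ψ.toMonoidHom)) where
  injective := e.injective.comp (h.injective.comp ψ.injective)
  exists_eq_mul y := by
    obtain ⟨q, s, hs, hy⟩ := h.exists_eq_mul (e.symm y)
    refine ⟨ψ.symm q, e s, ?_, ?_⟩
    · rw [mem_homCent_iff] at *
      intro q
      simpa using congrArg e (hs (ψ q))
    · simpa [MulEquiv.symm_apply_eq] using hy

theorem IsTyping.congr {β : P →* G} {i : Q →* P} (h : IsTyping p β i) (e : P ≃* P')
    (ψ : Q ≃* Q) :
    IsTyping p (β.comp e.symm.toMonoidHom) (e.toMonoidHom.comp (i.comp ψ.toMonoidHom)) where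
  injective := h.injective.comp e.symm.injective
  kCond := by
    have : (β.comp e.symm.toMonoidHom).range = β.range := by
      rw [MonoidHom.range_comp, MonoidHom.range_eq_top_of_surjective _ e.symm.surjective,
        ← MonoidHom.range_eq_map]
    have hk := h.kCond
    unfold KCond at *
    rwa [this]
  isCentric := h.isCentric.congr e ψ
  isNormalizerMaximal := by
    have hC : homCent ((β.comp e.symm.toMonoidHom).comp
        (e.toMonoidHom.comp (i.comp ψ.toMonoidHom))) = homCent (β.comp i) := by
      ext x
      simp only [mem_homCent_iff]
      exact ⟨fun hx q => by simpa using hx (ψ.symm q), fun hx q => by simpa using hx (ψ q)⟩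
    have hS : (homCent (e.toMonoidHom.comp (i.comp ψ.toMonoidHom))).map
        (β.comp e.symm.toMonoidHom) = (homCent i).map β := by
      ext x
      constructor
      · rintro ⟨s, hs, rfl⟩
        refine ⟨e.symm s, mem_homCent_iff.2 fun q => ?_, rfl⟩
        simpa using congrArg e.symm (mem_homCent_iff.1 hs (ψ.symm q))
      · rintro ⟨s, hs, rfl⟩
        refine ⟨e s, mem_homCent_iff.2 fun q => ?_, by simp⟩
        simpa using congrArg e (mem_homCent_iff.1 hs (ψ q))
    rw [hC, hS]
    exact h.isNormalizerMaximal

theorem IsTyping.exists_mulEquiv [Finite G] (hp : p.Prime) (hP : IsPGroup p P)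
    (hP' : IsPGroup p P') {β : P →* G} {i : Q →* P} (h : IsTyping p β i) {β' : P' →* G}
    {i' : Q →* P'} (h' : IsTyping p β' i') {x : G} (hx : ∀ q, β' (i' q) = x⁻¹ * β (i q) * x) :
    ∃ φ : P ≃* P', (∀ q, φ (i q) = i' q) ∧ ∃ g, ∀ y, β' (φ y) = g * β y * g⁻¹ := by
  have := Fact.mk hp
  set γ := (MulAut.conj x⁻¹).toMonoidHom.comp β with hγ
  have hγi : γ.comp i = β'.comp i' := by
    ext q
    simp [hγ, hx]
  have hγy (y : P) : γ y = x⁻¹ * β y * x := by simp [hγ]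
  have hT : IsTyping p γ i := h.conj hp _
  obtain ⟨c, hc, hcS⟩ := hT.isNormalizerMaximal.exists_conj (map_homCent_le _ _)
    ((hP.to_subgroup _).map _) (S' := (homCent i').map β') (hγi ▸ map_homCent_le _ _)
    ((hP'.to_subgroup _).map _) (by rw [hγi]; exact h'.isNormalizerMaximal)
  have hcq (q : Q) : c * γ (i q) * c⁻¹ = β' (i' q) := by
    rw [mul_inv_eq_iff_eq_mul, ← MonoidHom.comp_apply β', ← hγi]
    exact mem_homCent_iff.1 hc q
  let δ := (MulAut.conj c).toMonoidHom.comp γ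
  have hδy (y : P) : δ y = c * γ y * c⁻¹ := rfl
  have hδ : Function.Injective δ := (MulAut.conj c).injective.comp hT.injective
  have hr : δ.range = β'.range := by
    ext z
    constructor
    · rintro ⟨y, rfl⟩
      obtain ⟨q, s, hs, rfl⟩ := h.isCentric.exists_eq_mul y
      obtain ⟨s', -, e⟩ := (hcS (γ s)).1 ⟨s, hs, rfl⟩
      exact ⟨i' q * s', by rw [map_mul, map_mul, e, hδy, hδy, hcq]⟩
    · rintro ⟨y, rfl⟩
      obtain ⟨q, s, hs, rfl⟩ := h'.isCentric.exists_eq_mul y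
      obtain ⟨s', -, e⟩ := (hcS (c⁻¹ * β' s * c)).2 ⟨s, hs, by group⟩
      refine ⟨i q * s', ?_⟩
      rw [map_mul, map_mul, hδy, hδy, hcq, e]
      group
  obtain ⟨φ, hφ⟩ := exists_mulEquiv_of_range_eq hδ h'.injective hr
  refine ⟨φ, fun q => h'.injective ?_, c * x⁻¹, fun y => ?_⟩
  · rw [hφ, hδy, hcq]
  · rw [hφ, hδy, hγy]
    group

theorem exists_isTyping [Finite Q] [Finite G] (hp : p.Prime) (hQ : IsPGroup p Q) {α : Q →* G}
    (hα : Function.Injective α) : ∃ (P : Subgroup G) (i : Q →* P),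
      IsPGroup p P ∧ IsTyping p P.subtype i ∧ P.subtype.comp i = α := by
  have := Fact.mk hp
  obtain ⟨T⟩ : Nonempty (Sylow p (homCent α)) := inferInstance
  set S := (T : Subgroup (homCent α)).map (homCent α).subtype with hS
  have hSC : S ≤ homCent α := Subgroup.map_subtype_le _
  have hmax : IsNormalizerMaximal p (homCent α) S := T.isNormalizerMaximal
  have hSp : IsPGroup p S := T.isPGroup'.map _
  let m : Q × S →* G := MonoidHom.noncommCoprod α S.subtype fun q s =>
    ((mem_homCent_iff.1 (hSC s.2) q).symm : α q * s = s * α q)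
  have hm (q : Q) (s : S) : m (q, s) = α q * s := rfl
  have hPp : IsPGroup p m.range := by
    refine IsPGroup.of_surjective (G := Q × S) ?_ m.rangeRestrict m.rangeRestrict_surjective
    rintro ⟨q, s⟩
    obtain ⟨a, ha⟩ := hQ q
    obtain ⟨b, hb⟩ := hSp s
    refine ⟨a + b, Prod.ext ?_ ?_⟩
    · simp [pow_add, pow_mul, ha]
    · simp only [Prod.pow_snd, Prod.snd_one]
      rw [pow_add, mul_comm, pow_mul, hb, one_pow]
  have hSP (s : G) (hs : s ∈ S) : s ∈ m.range := ⟨(1, ⟨s, hs⟩), by simp [hm]⟩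
  let i : Q →* m.range := α.codRestrict m.range fun q => ⟨(q, 1), by simp [hm]⟩
  have hi (q : Q) : (i q : G) = α q := rfl
  have hcomp : m.range.subtype.comp i = α := by ext; rfl
  have hpow (y : G) (hy : y ∈ m.range) : ∃ n : ℕ, y ^ p ^ n = 1 := by
    obtain ⟨n, hn⟩ := hPp ⟨y, hy⟩
    exact ⟨n, congrArg Subtype.val hn⟩
  have hcent : (homCent i).map m.range.subtype = S := by
    ext y
    constructor
    · rintro ⟨⟨y, hyP⟩, hy, rfl⟩
      have hyC : y ∈ homCent α := mem_homCent_iff.2 fun q =>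
        congrArg Subtype.val (mem_homCent_iff.1 hy q)
      obtain ⟨⟨q, s⟩, rfl⟩ := hyP
      rw [hm] at hyC
      have hqC : α q ∈ homCent α := ((homCent α).mul_mem_cancel_right (hSC s.2)).1 hyC
      refine S.mul_mem (hmax _ hqC (hpow _ ⟨(q, 1), by simp [hm]⟩) fun s hs => ?_) s.2
      rwa [← mem_homCent_iff.1 (hSC hs) q, mul_inv_cancel_right]
    · intro hy
      refine ⟨⟨y, hSP y hy⟩, mem_homCent_iff.2 fun q => Subtype.ext ?_, rfl⟩
      exact mem_homCent_iff.1 (hSC hy) q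
  refine ⟨m.range, i, hPp, ⟨Subtype.val_injective, ?_, ⟨?_, ?_⟩, ?_⟩, hcomp⟩
  · rw [kCond_iff hp, Subgroup.range_subtype]
    intro u hu hn
    rw [mem_homCent_iff] at hu
    refine hSP u (hmax u (mem_homCent_iff.2 fun q => hu (i q)) hn fun s hs => ?_)
    have : u * s = s * u := hu ⟨s, hSP s hs⟩
    rwa [this, mul_inv_cancel_right]
  · exact fun a b hab => hα (congrArg Subtype.val hab)
  · rintro ⟨-, ⟨q, s⟩, rfl⟩
    refine ⟨q, ⟨s, hSP _ s.2⟩, mem_homCent_iff.2 fun q => Subtype.ext ?_, rfl⟩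
    exact mem_homCent_iff.1 (hSC s.2) q
  · rw [hcomp, hcent]
    exact hmax

theorem IsCentric.surjective_of_kCond [Finite G] (hp : p.Prime) (hP : IsPGroup p P)
    {i : Q →* P} (hi : IsCentric i) {β : P →* G} (hβ : Function.Injective β)
    (h : KCond p (β.comp i)) : Function.Surjective i := by
  rw [kCond_iff hp] at h
  intro y
  obtain ⟨q, s, hs, rfl⟩ := hi.exists_eq_mul y
  obtain ⟨q', hq'⟩ := h (β s) (map_homCent_le _ _ ⟨s, hs, rfl⟩) (by
    obtain ⟨n, hn⟩ := hP s
    exact ⟨n, by rw [← map_pow, hn, map_one]⟩)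
  exact ⟨q * q', by rw [map_mul, hβ hq']⟩

theorem KCond.comp_of_surjective {β : P →* G} (h : KCond p β) {i : Q →* P}
    (hi : Function.Surjective i) : KCond p (β.comp i) := by
  have : (β.comp i).range = β.range := by
    rw [MonoidHom.range_comp, MonoidHom.range_eq_top_of_surjective _ hi, ← MonoidHom.range_eq_map]
  unfold KCond at *
  rwa [this]

end Typing

section Pairs

variable {p : ℕ} {Q P P' G : Type} [Group Q] [Group P] [Group P'] [Group G]

instance [Finite Q] : Finite (Out Q) :=
  have : Finite (MulAut Q) := Finite.of_injective _ DFunLike.coe_injective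
  inferInstanceAs (Finite (MulAut Q ⧸ Inn Q))

instance [Finite Q] [Finite G] : Finite (RepCl Q G) :=
  have : Finite (Q →* G) := Finite.of_injective _ DFunLike.coe_injective
  inferInstanceAs (Finite (Quotient (homConjSetoid Q G)))

instance [Finite Q] [Finite G] : Finite (InjCl Q G) :=
  inferInstanceAs (Finite {c : RepCl Q G // IsInjClass c})

instance [Finite Q] [Finite G] : Finite (KCl p Q G) :=
  inferInstanceAs (Finite {c : RepCl Q G // IsKClass p c})

theorem repCl_mk_eq_iff {f g : Q →* G} :
    (⟦f⟧ : RepCl Q G) = ⟦g⟧ ↔ ∃ x : G, ∀ q, g q = x⁻¹ * f q * x := Quotient.eq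

/-- The class of an automorphism. -/
def Out.mk (φ : MulAut Q) : Out Q := (QuotientGroup.mk φ : MulAut Q ⧸ Inn Q)

theorem Out.mk_surjective : Function.Surjective (Out.mk (Q := Q)) := QuotientGroup.mk_surjective

theorem Out.mk_pow (φ : MulAut Q) (n : ℕ) : Out.mk (φ ^ n) = Out.mk φ ^ n := rfl

theorem Out.mk_mul (φ ψ : MulAut Q) : Out.mk (φ * ψ) = Out.mk φ * Out.mk ψ := rfl

theorem Out.mk_eq_one_iff (φ : MulAut Q) : Out.mk φ = 1 ↔ ∃ x, φ = MulAut.conj x := by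
  refine (QuotientGroup.eq_one_iff φ).trans ?_
  simp [Inn, MonoidHom.mem_range, eq_comm]

variable (Q P) in
/-- Classes of homomorphisms `i : Q → P` with `IsCentric i`. -/
def CentricCl : Type := {c : RepCl Q P // ∃ i : Q →* P, IsCentric i ∧ (⟦i⟧ : RepCl Q P) = c}

/-- Postcomposition of a class of homomorphisms with an outer automorphism. -/
def postComp (o : Out P) (c : RepCl Q P) : RepCl Q P :=
  Quotient.liftOn' o
    (fun φ : MulAut P => Quotient.map (fun i : Q →* P => φ.toMonoidHom.comp i)
      (by rintro f g ⟨x, hx⟩; exact ⟨φ x, fun q => by simp [hx]⟩) c)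
    (by
      intro φ ψ h
      rw [QuotientGroup.leftRel_apply] at h
      obtain ⟨x, hx⟩ := h
      obtain rfl : ψ = φ * MulAut.conj x := by rw [hx]; group
      induction c using Quotient.inductionOn with
      | h i => exact Quotient.sound ⟨(φ x)⁻¹, fun q => by simp⟩)

variable (p Q P G) in
/-- Pairs of a class in `K(P, G)` and a class of homomorphisms `Q → P`. -/
def PairCl : Type := KCl p P G × CentricCl Q P

namespace PairCl

instance [Finite Q] [Finite P] [Finite G] : Finite (PairCl p Q P G) :=
  have : Finite (CentricCl Q P) :=
    inferInstanceAs (Finite {c : RepCl Q P // ∃ i : Q →* P, IsCentric i ∧ (⟦i⟧ : RepCl Q P) = c})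
  inferInstanceAs (Finite (KCl p P G × CentricCl Q P))

/-- The outer automorphism group of the intermediate group acts on both factors. -/
instance : MulAction (Out P) (PairCl p Q P G) where
  smul o x := (o • x.1, ⟨postComp o x.2.1, by
    obtain ⟨_, _, i, hi, rfl⟩ := x
    obtain ⟨φ, rfl⟩ := Out.mk_surjective o
    exact ⟨_, hi.congr φ (MulEquiv.refl Q), rfl⟩⟩)
  one_smul x := by
    obtain ⟨c, _, i, hi, rfl⟩ := x
    exact Prod.ext (one_smul _ c) (Subtype.ext rfl)
  mul_smul o₁ o₂ x := by
    obtain ⟨c, _, i, hi, rfl⟩ := x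
    obtain ⟨φ₁, rfl⟩ := Out.mk_surjective o₁
    obtain ⟨φ₂, rfl⟩ := Out.mk_surjective o₂
    exact Prod.ext (mul_smul _ _ c) (Subtype.ext rfl)

/-- The outer automorphism group of the source acts on the second factor. -/
instance : MulAction (Out Q) (PairCl p Q P G) where
  smul o x := (x.1, ⟨o • x.2.1, by
    obtain ⟨_, _, i, hi, rfl⟩ := x
    obtain ⟨φ, rfl⟩ := Out.mk_surjective o
    exact ⟨_, hi.congr (MulEquiv.refl P) φ⁻¹, rfl⟩⟩)
  one_smul x := Prod.ext rfl (Subtype.ext (one_smul _ x.2.1))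
  mul_smul o₁ o₂ x := Prod.ext rfl (Subtype.ext (mul_smul o₁ o₂ x.2.1))

instance : SMulCommClass (Out Q) (Out P) (PairCl p Q P G) where
  smul_comm o₁ o₂ x := by
    obtain ⟨c, _, i, hi, rfl⟩ := x
    obtain ⟨φ₁, rfl⟩ := Out.mk_surjective o₁
    obtain ⟨φ₂, rfl⟩ := Out.mk_surjective o₂
    exact Prod.ext rfl (Subtype.ext rfl)

/-- The pair of classes of two homomorphisms. -/
def mk (β : P →* G) (hβ : Function.Injective β) (hK : KCond p β) (i : Q →* P)
    (hi : IsCentric i) : PairCl p Q P G :=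
  (⟨⟦β⟧, β, hβ, hK, rfl⟩, ⟨⟦i⟧, i, hi, rfl⟩)

theorem exists_eq_mk (x : PairCl p Q P G) : ∃ β hβ hK i hi, x = mk (p := p) β hβ hK i hi := by
  obtain ⟨⟨_, β, hβ, hK, rfl⟩, _, i, hi, rfl⟩ := x
  exact ⟨β, hβ, hK, i, hi, rfl⟩

/-- Composition of the two members of a pair. -/
def comp (x : PairCl p Q P G) : RepCl Q G :=
  Quotient.map₂ (fun (β : P →* G) (i : Q →* P) => β.comp i)
    (by
      rintro β β' ⟨g, hg⟩ i i' ⟨x, hx⟩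
      exact ⟨β x * g, fun q => by simp [hx, hg, mul_assoc]⟩) x.1.1 x.2.1

theorem comp_smul (o : Out Q) (x : PairCl p Q P G) : (o • x).comp = o • x.comp := by
  obtain ⟨β, hβ, hK, i, hi, rfl⟩ := x.exists_eq_mk
  obtain ⟨φ, rfl⟩ := Out.mk_surjective o
  rfl

theorem smul_mk_eq_iff (o : Out P) {β β' : P →* G} (hβ hK hβ' hK') {i i' : Q →* P} (hi hi') :
    o • mk (p := p) β hβ hK i hi = mk β' hβ' hK' i' hi' ↔
      ∃ φ : MulAut P, Out.mk φ = o ∧ (∀ q, φ (i q) = i' q) ∧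
        ∃ g, ∀ y, β' (φ y) = g * β y * g⁻¹ := by
  constructor
  · intro h
    obtain ⟨ψ, rfl⟩ := Out.mk_surjective o
    obtain ⟨w, hw⟩ := repCl_mk_eq_iff.1 (congrArg (fun z => z.1.1) h)
    obtain ⟨x, hx⟩ := repCl_mk_eq_iff.1 (congrArg (fun z => z.2.1) h)
    refine ⟨MulAut.conj x⁻¹ * ψ, ?_, fun q => ?_, (β (ψ⁻¹ x) * w)⁻¹, fun y => ?_⟩
    · rw [Out.mk_mul, (Out.mk_eq_one_iff _).2 ⟨_, rfl⟩, one_mul]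
    · simp [hx]
    · rw [hw]
      simp [mul_assoc]
  · rintro ⟨φ, rfl, hφ, g, hg⟩
    refine Prod.ext (Subtype.ext ?_) (Subtype.ext ?_)
    · refine repCl_mk_eq_iff.2 ⟨g⁻¹, fun y => ?_⟩
      have := hg (φ⁻¹ y)
      simpa using this
    · exact repCl_mk_eq_iff.2 ⟨1, fun q => by simp [hφ]⟩

end PairCl

/-- Iterating an automorphism of the source of `β` that is induced by conjugation. -/
theorem map_pow_apply {β : P →* G} {φ : MulAut P} {g : G} (h : ∀ y, β (φ y) = g * β y * g⁻¹)
    (n : ℕ) (y : P) : β ((φ ^ n) y) = g ^ n * β y * (g ^ n)⁻¹ := by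
  induction n generalizing y with
  | zero => simp
  | succ n ih =>
    rw [pow_succ, MulAut.mul_apply, ih, h]
    group

theorem isReg_mk_iff [Finite P] [Finite G] (hp : p.Prime) (hP : IsPGroup p P) (β : P →* G)
    (hβ : Function.Injective β) (hK : KCond p β) (i : Q →* P) (hi : IsCentric i) :
    IsReg p (Out P) (PairCl.mk (p := p) β hβ hK i hi) ↔ IsTyping p β i := by
  have := Fact.mk hp
  constructor
  · intro hreg
    refine ⟨hβ, hK, hi, ?_⟩
    rintro t ht ⟨n, hn⟩ hS
    have hr : ((MulAut.conj t).toMonoidHom.comp β).range ≤ β.range := by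
      rintro - ⟨y, rfl⟩
      obtain ⟨q, s, hs, rfl⟩ := hi.exists_eq_mul y
      obtain ⟨s', -, e⟩ := hS _ ⟨s, hs, rfl⟩
      refine ⟨i q * s', ?_⟩
      have h1 : t * β (i q) = β (i q) * t := mem_homCent_iff.1 ht q
      simp only [map_mul, e, MonoidHom.comp_apply, MulEquiv.coe_toMonoidHom, MulAut.conj_apply]
      simp only [← mul_assoc, h1]
      group
    have hinj := (MulAut.conj t).injective.comp hβ
    have hr' : ((MulAut.conj t).toMonoidHom.comp β).range = β.range := by
      refine Subgroup.eq_of_le_of_card_ge hr ?_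
      rw [← Nat.card_congr (MonoidHom.ofInjective hβ).toEquiv,
        ← Nat.card_congr (MonoidHom.ofInjective
          (f := (MulAut.conj t).toMonoidHom.comp β) hinj).toEquiv]
    obtain ⟨φ, hφ⟩ := exists_mulEquiv_of_range_eq hinj hβ hr'
    replace hφ : ∀ y, β (φ y) = t * β y * t⁻¹ := hφ
    let φ : MulAut P := φ
    have hφi (q : Q) : φ (i q) = i q := by
      apply hβ
      rw [hφ, mul_inv_eq_iff_eq_mul]
      exact mem_homCent_iff.1 ht q
    have hst : Out.mk φ ∈ MulAction.stabilizer (Out P) (PairCl.mk (p := p) β hβ hK i hi) :=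
      (PairCl.smul_mk_eq_iff _ _ _ _ _ _ _).2 ⟨φ, rfl, hφi, t, hφ⟩
    have hφn : φ ^ p ^ n = 1 := by
      ext y
      apply hβ
      rw [map_pow_apply hφ, hn]
      simp
    have hone : Out.mk φ = 1 := by
      have h1 := Subgroup.orderOf_dvd_natCard _ hst
      have h2 : orderOf (Out.mk φ) ∣ p ^ n := orderOf_dvd_of_pow_eq_one (by
        rw [← Out.mk_pow, hφn]
        rfl)
      rw [← orderOf_eq_one_iff]
      exact Nat.eq_one_of_dvd_coprimes
        (((Nat.Prime.coprime_iff_not_dvd hp).2 hreg).pow_left n) h2 h1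
    obtain ⟨x, hx⟩ := (Out.mk_eq_one_iff _).1 hone
    have hxy (y : P) : β x * β y * (β x)⁻¹ = t * β y * t⁻¹ := by
      rw [← hφ y]
      change _ = β (φ y)
      simp [hx]
    have hcomm : Commute (β x)⁻¹ t := by
      have := hxy x
      rw [mul_inv_cancel_right, eq_mul_inv_iff_mul_eq] at this
      exact Commute.inv_left this
    obtain ⟨m, hm⟩ := hP x
    obtain ⟨y, hy⟩ := (kCond_iff hp β).1 hK ((β x)⁻¹ * t) (mem_homCent_iff.2 fun y => by
      have := hxy y
      rw [mul_inv_eq_iff_eq_mul] at this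
      rw [mul_assoc, inv_mul_eq_iff_eq_mul, ← mul_assoc, ← mul_assoc, this]
      group) ⟨m + n, by
        rw [hcomm.mul_pow, pow_add, pow_mul, inv_pow, ← map_pow, hm, mul_comm (p ^ m), pow_mul, hn]
        simp⟩
    have hty : β (x * y) = t := by rw [map_mul, hy, mul_inv_cancel_left]
    exact ⟨x * y, mem_homCent_of_map_mem hβ (hty ▸ ht), hty⟩
  · rintro h hdvd
    obtain ⟨⟨o, ho⟩, hop⟩ := exists_prime_orderOf_dvd_card' p hdvd
    obtain ⟨φ, rfl, hφi, g, hg⟩ := (PairCl.smul_mk_eq_iff _ _ _ _ _ _ _).1 ho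
    have hgC : g ∈ homCent (β.comp i) := mem_homCent_iff.2 fun q => by
      have := hg (i q)
      rw [hφi, eq_mul_inv_iff_mul_eq] at this
      exact this.symm
    obtain ⟨a, m, hm, hgm⟩ := Nat.exists_eq_pow_mul_and_not_dvd (orderOf_pos g).ne' p hp.ne_one
    have hφm (q : Q) : (φ ^ m) (i q) = i q := by
      clear hm hgm
      induction m with
      | zero => simp
      | succ m ih => rw [pow_succ, MulAut.mul_apply, hφi, ih]
    obtain ⟨x, hx, e⟩ := h.isNormalizerMaximal (g ^ m) ((homCent _).pow_mem hgC m)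
      ⟨a, by rw [← pow_mul, mul_comm, ← hgm, pow_orderOf_eq_one]⟩ (by
        rintro - ⟨s, hs, rfl⟩
        refine ⟨(φ ^ m) s, mem_homCent_iff.2 fun q => ?_, map_pow_apply hg m s⟩
        have := congrArg (φ ^ m) (mem_homCent_iff.1 hs q)
        rwa [map_mul, map_mul, hφm] at this)
    have hone : Out.mk φ ^ m = 1 := by
      rw [← Out.mk_pow, Out.mk_eq_one_iff]
      refine ⟨x, MulEquiv.ext fun y => hβ ?_⟩
      rw [map_pow_apply hg, ← e]
      simp
    apply hm
    rw [← hop, Subgroup.orderOf_mk]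
    exact orderOf_dvd_of_pow_eq_one hone

end Pairs

section Types

variable {p : ℕ} {Q P P' G G₁ G₂ : Type} [Group Q] [Group P] [Group P'] [Group G] [Group G₁]
  [Group G₂]

theorem isKClass_mk_iff [Finite G] (hp : p.Prime) {f : Q →* G} (hf : Function.Injective f) :
    IsKClass p (⟦f⟧ : RepCl Q G) ↔ KCond p f := by
  refine ⟨?_, fun h => ⟨f, hf, h, rfl⟩⟩
  rintro ⟨g, -, hg, e⟩
  obtain ⟨x, hx⟩ := repCl_mk_eq_iff.1 e
  have := hg.conj hp x⁻¹
  convert this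
  ext q
  simp [hx]

/-- The class `z` factors as a composition `β ∘ i` through the `p`-group `P`, with
`IsTyping p β i`. -/
def HasType (p : ℕ) (P : Type) [Group P] (z : RepCl Q G) : Prop :=
  IsPGroup p P ∧ ∃ (β : P →* G) (i : Q →* P), IsTyping p β i ∧ (⟦β.comp i⟧ : RepCl Q G) = z

theorem HasType.of_mulEquiv {z : RepCl Q G} (h : HasType p P z) (e : P ≃* P') :
    HasType p P' z := by
  obtain ⟨hP, β, i, hβi, rfl⟩ := h
  refine ⟨hP.of_equiv e, _, _, hβi.congr e (MulEquiv.refl Q), ?_⟩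
  exact repCl_mk_eq_iff.2 ⟨1, fun q => by simp⟩

theorem HasType.iff_nonempty_mulEquiv [Finite G] (hp : p.Prime) {z : RepCl Q G}
    (h : HasType p P z) : HasType p P' z ↔ Nonempty (P ≃* P') := by
  refine ⟨fun h' => ?_, fun ⟨e⟩ => h.of_mulEquiv e⟩
  obtain ⟨hP, β, i, hβi, rfl⟩ := h
  obtain ⟨hP', β', i', hβi', e⟩ := h'
  obtain ⟨x, hx⟩ := repCl_mk_eq_iff.1 e.symm
  obtain ⟨φ, -⟩ := hβi.exists_mulEquiv hp hP hP' hβi' hx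
  exact ⟨φ⟩

theorem HasType.smul {z : RepCl Q G} (h : HasType p P z) (o : Out Q) : HasType p P (o • z) := by
  obtain ⟨hP, β, i, hβi, rfl⟩ := h
  obtain ⟨ψ, rfl⟩ := Out.mk_surjective o
  exact ⟨hP, _, _, hβi.congr (MulEquiv.refl P) ψ⁻¹, rfl⟩

theorem hasType_smul_iff (z : RepCl Q G) (o : Out Q) : HasType p P (o • z) ↔ HasType p P z :=
  ⟨fun h => by simpa using h.smul o⁻¹, fun h => h.smul o⟩

theorem HasType.finite [Finite G] {z : RepCl Q G} (h : HasType p P z) : Finite P := by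
  obtain ⟨_, β, _, hβi, _⟩ := h
  exact Finite.of_injective _ hβi.injective

theorem HasType.isInjClass {z : RepCl Q G} (h : HasType p P z) : IsInjClass z := by
  obtain ⟨-, β, i, hβi, rfl⟩ := h
  exact ⟨_, hβi.injective.comp hβi.isCentric.injective, rfl⟩

theorem HasType.not_isKClass_iff [Finite Q] [Finite G] (hp : p.Prime) {z : RepCl Q G}
    (h : HasType p P z) : ¬ IsKClass p z ↔ Nat.card Q < Nat.card P := by
  have := h.finite
  obtain ⟨hP, β, i, hβi, rfl⟩ := h
  have hi := hβi.isCentric.injective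
  have hβi' : Function.Injective (β.comp i) := hβi.injective.comp hi
  rw [isKClass_mk_iff hp hβi']
  constructor
  · intro hK
    refine lt_of_le_of_ne (Nat.card_le_card_of_injective i hi) fun hcard => hK ?_
    exact hβi.kCond.comp_of_surjective
      ((Nat.bijective_iff_injective_and_card i).2 ⟨hi, hcard⟩).2
  · intro hlt hK
    have hs := hβi.isCentric.surjective_of_kCond hp hP hβi.injective hK
    exact hlt.not_ge (Nat.card_le_card_of_surjective i hs)

theorem exists_hasType [Finite Q] [Finite G] (hp : p.Prime) (hQ : IsPGroup p Q) {z : RepCl Q G}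
    (hz : IsInjClass z) : ∃ (P : Type) (_ : Group P), HasType p P z := by
  obtain ⟨α, hα, rfl⟩ := hz
  obtain ⟨P, i, hP, hT, rfl⟩ := exists_isTyping hp hQ hα
  exact ⟨P, inferInstance, hP, _, _, hT, rfl⟩

theorem KCl.isKClass_smul (c : KCl p Q G) (o : Out Q) : IsKClass p (o • c.1) := (o • c).2

theorem isKClass_smul_iff (z : RepCl Q G) (o : Out Q) : IsKClass p (o • z) ↔ IsKClass p z :=
  ⟨fun h => by simpa using KCl.isKClass_smul ⟨_, h⟩ o⁻¹, fun h => KCl.isKClass_smul ⟨_, h⟩ o⟩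

variable (p Q G) in
/-- The classes in `Inj(Q, G)` outside `K(Q, G)`. -/
def nonK : SubMulAction (Out Q) (InjCl Q G) where
  carrier := {c | ¬ IsKClass p c.1}
  smul_mem' o c hc := mt (isKClass_smul_iff c.1 o).1 hc

/-- The collection of groups through which a class factors. -/
def typeOf (x : nonK p Q G) : (P : Type) → Group P → Prop := fun P _ => HasType p P x.1.1

variable (P) in
/-- The collection of groups isomorphic to `P`. -/
def isoType : (P' : Type) → Group P' → Prop := fun P' _ => Nonempty (P ≃* P')

theorem typeOf_smul (o : Out Q) (x : nonK p Q G) : typeOf (o • x) = typeOf x := by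
  funext P _
  exact propext (hasType_smul_iff x.1.1 o)

theorem typeOf_eq_iff [Finite G] (hp : p.Prime) (x : nonK p Q G) :
    typeOf x = isoType P ↔ HasType p P x.1.1 := by
  constructor
  · intro h
    have : typeOf x P inferInstance ↔ Nonempty (P ≃* P) := by rw [h]; rfl
    exact this.2 ⟨MulEquiv.refl P⟩
  · intro h
    funext P' _
    exact propext (h.iff_nonempty_mulEquiv hp)

theorem PairCl.hasType_comp [Finite P] [Finite G] (hp : p.Prime) (hP : IsPGroup p P)
    (x : {x : PairCl p Q P G // IsReg p (Out P) x}) : HasType p P x.1.comp := by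
  obtain ⟨x, hx⟩ := x
  obtain ⟨β, hβ, hK, i, hi, rfl⟩ := x.exists_eq_mk
  exact ⟨hP, β, i, (isReg_mk_iff hp hP β hβ hK i hi).1 hx, rfl⟩

/-- Composition of pairs, as a map to classes of a given type. -/
def regComp [Finite Q] [Finite P] [Finite G] (hp : p.Prime) (hP : IsPGroup p P)
    (hlt : Nat.card Q < Nat.card P) (x : {x : PairCl p Q P G // IsReg p (Out P) x}) :
    fiberAction (typeOf (p := p) (Q := Q) (G := G)) typeOf_smul (isoType P) :=
  have h := PairCl.hasType_comp hp hP x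
  ⟨⟨⟨x.1.comp, h.isInjClass⟩, (h.not_isKClass_iff hp).2 hlt⟩, (typeOf_eq_iff hp _).2 h⟩

theorem isRegQuotient_regComp [Finite Q] [Finite P] [Finite G] (hp : p.Prime)
    (hP : IsPGroup p P) (hlt : Nat.card Q < Nat.card P) :
    IsRegQuotient (L := Out Q) p (regComp (G := G) hp hP hlt) where
  surjective := by
    rintro ⟨⟨⟨z, hz⟩, hK⟩, ht⟩
    obtain ⟨-, β, i, hβi, e⟩ := (typeOf_eq_iff hp _).1 ht
    refine ⟨⟨PairCl.mk β hβi.injective hβi.kCond i hβi.isCentric,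
      (isReg_mk_iff hp hP _ _ _ _ _).2 hβi⟩, ?_⟩
    exact Subtype.ext (Subtype.ext (Subtype.ext (by exact e)))
  eq_iff := by
    rintro ⟨x, hx⟩ ⟨y, hy⟩
    obtain ⟨β, hβ, hK, i, hi, rfl⟩ := x.exists_eq_mk
    obtain ⟨β', hβ', hK', i', hi', rfl⟩ := y.exists_eq_mk
    have hβi := (isReg_mk_iff hp hP _ _ _ _ _).1 hx
    have hβi' := (isReg_mk_iff hp hP _ _ _ _ _).1 hy
    have : regComp (G := G) hp hP hlt ⟨_, hx⟩ = regComp hp hP hlt ⟨_, hy⟩ ↔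
        (⟦β.comp i⟧ : RepCl Q G) = ⟦β'.comp i'⟧ :=
      ⟨fun h => congrArg (fun w => w.1.1.1) h,
        fun h => Subtype.ext (Subtype.ext (Subtype.ext h))⟩
    rw [this, repCl_mk_eq_iff]
    simp only [PairCl.smul_mk_eq_iff]
    constructor
    · rintro ⟨w, hw⟩
      obtain ⟨φ, hφ, hg⟩ := hβi.exists_mulEquiv hp hP hP hβi' hw
      exact ⟨Out.mk φ, φ, rfl, hφ, hg⟩
    · rintro ⟨-, φ, rfl, hφ, g, hg⟩
      refine ⟨g⁻¹, fun q => ?_⟩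
      simp [← hφ, hg]
  map_smul o x := Subtype.ext (Subtype.ext (Subtype.ext (by exact PairCl.comp_smul o x.1)))

/-- An isomorphism on the first factor induces one on pairs. -/
theorem exists_pair_equiv {k : Type} [CommRing k]
    (h : PermIso k (Out P) (KCl p P G₁) (KCl p P G₂)) :
    ∃ e : (PairCl p Q P G₁ → k) ≃ₗ[k] (PairCl p Q P G₂ → k),
      (∀ (o : Out P) f, e (fun x => f (o • x)) = fun y => e f (o • y)) ∧
      ∀ (o : Out Q) f, e (fun x => f (o • x)) = fun y => e f (o • y) := by
  obtain ⟨e, he⟩ := h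
  refine ⟨LinearEquiv.ofLinearMap
    { toFun := fun f y => e (fun c => f (c, y.2)) y.1
      map_add' := fun f g => by ext y; exact congrFun (map_add e _ _) _
      map_smul' := fun c f => by ext y; exact congrFun (map_smul e c _) _ }
    { toFun := fun f x => e.symm (fun c => f (c, x.2)) x.1
      map_add' := fun f g => by ext y; exact congrFun (map_add e.symm _ _) _
      map_smul' := fun c f => by ext y; exact congrFun (map_smul e.symm c _) _ } ?_ ?_, ?_, ?_⟩
  · refine LinearMap.ext fun f => funext fun y => ?_
    exact congrFun (e.apply_symm_apply fun c => f (c, y.2)) y.1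
  · refine LinearMap.ext fun f => funext fun x => ?_
    exact congrFun (e.symm_apply_apply fun c => f (c, x.2)) x.1
  · intro o f
    funext y
    exact congrFun (he o fun c => f (c, (o • y).2)) y.1
  · intro o f
    rfl

theorem permIso_nonK [Finite Q] [Finite G₁] [Finite G₂] (hp : p.Prime) (hQ : IsPGroup p Q)
    (h : ∀ (P : Type) [Group P] [Finite P], IsPGroup p P → Nat.card Q < Nat.card P →
      PermIso (ZMod p) (Out P) (KCl p P G₁) (KCl p P G₂)) :
    PermIso (ZMod p) (Out Q) (nonK p Q G₁) (nonK p Q G₂) := by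
  have := Fact.mk hp
  refine PermIso.of_fibers typeOf typeOf typeOf_smul typeOf_smul fun t => ?_
  by_cases ht : ∃ (P : Type) (_ : Group P), Finite P ∧ IsPGroup p P ∧ Nat.card Q < Nat.card P ∧
      t = isoType P
  · obtain ⟨P, _, _, hP, hlt, rfl⟩ := ht
    obtain ⟨e, heH, heL⟩ := exists_pair_equiv (Q := Q) (h P hP hlt)
    exact (isRegQuotient_regComp hp hP hlt).permIso (isRegQuotient_regComp hp hP hlt) e heH heL
  · have hempty (G : Type) [Group G] [Finite G] :
        IsEmpty (fiberAction (typeOf (p := p) (Q := Q) (G := G)) typeOf_smul t) := by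
      refine ⟨fun ⟨x, hx⟩ => ht ?_⟩
      obtain ⟨P, _, hT⟩ := exists_hasType hp hQ x.1.2
      refine ⟨P, inferInstance, hT.finite, hT.1, (hT.not_isKClass_iff hp).1 x.2, ?_⟩
      rw [← (typeOf_eq_iff hp x).2 hT]
      exact Eq.symm hx
    have := hempty G₁
    have := hempty G₂
    exact PermIso.of_equiv (Equiv.equivOfIsEmpty _ _) fun _ x => isEmptyElim x

theorem permIso_injCl_sum (k : Type) [CommRing k] :
    PermIso k (Out Q) (KCl p Q G ⊕ nonK p Q G) (InjCl Q G) := by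
  let f : KCl p Q G ⊕ nonK p Q G → InjCl Q G := Sum.elim
    (fun c => ⟨c.1, let ⟨f, hf, _, e⟩ := c.2; ⟨f, hf, e⟩⟩) Subtype.val
  have hf : Function.Bijective f := by
    constructor
    · rintro (c | c) (d | d) hcd
      · have hv := congrArg Subtype.val hcd
        exact congrArg Sum.inl (Subtype.ext hv)
      · have hv : c.1 = d.1.1 := congrArg Subtype.val hcd
        exact absurd (hv ▸ c.2) d.2
      · have hv : c.1.1 = d.1 := congrArg Subtype.val hcd
        exact absurd (hv ▸ d.2) c.2
      · exact congrArg Sum.inr (Subtype.ext hcd)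
    · intro c
      by_cases hc : IsKClass p c.1
      · exact ⟨Sum.inl ⟨c.1, hc⟩, rfl⟩
      · exact ⟨Sum.inr ⟨c, hc⟩, rfl⟩
  refine PermIso.of_equiv (Equiv.ofBijective f hf) ?_
  rintro o (c | c) <;> rfl

theorem permIso_injCl_iff [Finite Q] [Finite G₁] [Finite G₂] (hp : p.Prime)
    (h : PermIso (ZMod p) (Out Q) (nonK p Q G₁) (nonK p Q G₂)) :
    PermIso (ZMod p) (Out Q) (InjCl Q G₁) (InjCl Q G₂) ↔
      PermIso (ZMod p) (Out Q) (KCl p Q G₁) (KCl p Q G₂) := by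
  have := Fact.mk hp
  have h₁ := permIso_injCl_sum (p := p) (Q := Q) (G := G₁) (ZMod p)
  have h₂ := permIso_injCl_sum (p := p) (Q := Q) (G := G₂) (ZMod p)
  constructor
  · intro hI
    exact ((h₁.trans hI).trans h₂.symm).of_sum h
  · intro hK
    exact (h₁.symm.trans (hK.sum h)).trans h₂

theorem isEmpty_kCl [Finite G] (h : Nat.card G < Nat.card Q) : IsEmpty (KCl p Q G) :=
  ⟨fun ⟨_, f, hf, _⟩ => h.not_ge (Nat.card_le_card_of_injective f hf)⟩

theorem permIso_kCl_of_permIso_injCl [Finite G₁] [Finite G₂] (hp : p.Prime)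
    (h : ∀ (Q : Type) [Group Q] [Finite Q], IsPGroup p Q →
      PermIso (ZMod p) (Out Q) (InjCl Q G₁) (InjCl Q G₂))
    (Q : Type) [Group Q] [Finite Q] (hQ : IsPGroup p Q) :
    PermIso (ZMod p) (Out Q) (KCl p Q G₁) (KCl p Q G₂) := by
  induction hn : Nat.card G₁ + Nat.card G₂ + 1 - Nat.card Q using Nat.strong_induction_on
    generalizing Q with
  | _ n ih =>
    by_cases hlt : Nat.card G₁ + Nat.card G₂ < Nat.card Q
    · have := isEmpty_kCl (p := p) (Q := Q) (G := G₁) (by omega)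
      have := isEmpty_kCl (p := p) (Q := Q) (G := G₂) (by omega)
      exact PermIso.of_equiv (Equiv.equivOfIsEmpty _ _) fun _ x => isEmptyElim x
    · refine (permIso_injCl_iff hp (permIso_nonK hp hQ fun P _ _ hP hQP => ?_)).1 (h Q hQ)
      exact ih _ (by omega) P hP rfl

end Types

/-- **Martino–Priddy, Theorem 0.1, (3) ⟺ (4).**  For finite groups `G₁, G₂` and a prime `p`,
the permutation `F_p[Out Q]`-modules `F_p Inj(Q,Gᵢ)` are isomorphic for every finite `p`-group
`Q` iff the permutation modules `F_p K(Q,Gᵢ)` are isomorphic for every finite `p`-group `Q`. -/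
theorem inj_iso_iff_K_iso (p : ℕ) (hp : p.Prime)
    (G₁ G₂ : Type) [Group G₁] [Fintype G₁] [Group G₂] [Fintype G₂] :
    (∀ (Q : Type) [Group Q] [Fintype Q], IsPGroup p Q →
      Nonempty (Rep.ofMulAction (ZMod p) (Out Q) (InjCl Q G₁) ≅
        Rep.ofMulAction (ZMod p) (Out Q) (InjCl Q G₂))) ↔
    (∀ (Q : Type) [Group Q] [Fintype Q], IsPGroup p Q →
      Nonempty (Rep.ofMulAction (ZMod p) (Out Q) (KCl p Q G₁) ≅
        Rep.ofMulAction (ZMod p) (Out Q) (KCl p Q G₂))) := by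
  constructor
  · intro h Q _ _ hQ
    refine permIso_iff_rep.2 (permIso_kCl_of_permIso_injCl hp (fun P _ _ hP => ?_) Q hQ)
    have := Fintype.ofFinite P
    exact permIso_iff_rep.1 (h P hP)
  · intro h Q _ _ hQ
    refine permIso_iff_rep.2 ((permIso_injCl_iff hp (permIso_nonK hp hQ fun P _ _ hP _ => ?_)).2
      (permIso_iff_rep.1 (h Q hQ)))
    have := Fintype.ofFinite P
    exact permIso_iff_rep.1 (h P hP)
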